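/- For every natural number n ≥ 1, the total number of idempotent permutations on [n] (over all degrees k from 1 to n) equals the sum over k from 1 to n of C(n,k)·k^(n−k). -/

import Mathlib

/-- `(π, A)` is an idempotent permutation on `[n]` (modeled as `Fin n`, so the
element `1` of `[n]` corresponds to `0 : Fin n`): writing `C = π(A)`,
(i) `π` is strictly increasing on `A`;
(ii) `1 ∈ C` (i.e. `C` contains the least element of `Fin n`);
(iii) for all `u, v ∉ C` with `u < v` such that no element of `C` lies in the
half-open interval `(u, v]`, one has `π⁻¹(u) < π⁻¹(v)`. -/
def IsIdemPerm (n : ℕ) (π : Equiv.Perm (Fin n)) (A : Finset (Fin n)) : Prop :=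
  (∀ a ∈ A, ∀ a' ∈ A, a < a' → π a < π a') ∧
  (∃ a ∈ A, (π a : ℕ) = 0) ∧
  (∀ u v : Fin n, u ∉ A.image π → v ∉ A.image π → u < v →
    (¬ ∃ c ∈ A.image π, u < c ∧ c ≤ v) → π.symm u < π.symm v)

section IdemPerm

variable {n : ℕ} {A : Finset (Fin n)}

/-- The sorting key of a map `f` from the complement of `A` to `A`: each `a ∈ A` is immediately
followed by its fibre under `f`. -/
def blockKey (f : {x // x ∉ A} → {x // x ∈ A}) (x : Fin n) : ℕ :=
  if h : x ∈ A then 2 * (x : ℕ) else 2 * ((f ⟨x, h⟩ : Fin n) : ℕ) + 1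

theorem blockKey_of_mem (f : {x // x ∉ A} → {x // x ∈ A}) {x : Fin n} (h : x ∈ A) :
    blockKey f x = 2 * (x : ℕ) := dif_pos h

theorem blockKey_of_notMem (f : {x // x ∉ A} → {x // x ∈ A}) {x : Fin n} (h : x ∉ A) :
    blockKey f x = 2 * ((f ⟨x, h⟩ : Fin n) : ℕ) + 1 := dif_neg h

/-- The permutation listing the elements by increasing key, with ties broken by size. -/
def blockPerm (f : {x // x ∉ A} → {x // x ∈ A}) : Equiv.Perm (Fin n) :=
  (Tuple.sort (blockKey f)).symm

theorem eq_blockPerm_iff (f : {x // x ∉ A} → {x // x ∈ A}) (π : Equiv.Perm (Fin n)) :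
    blockPerm f = π ↔ (∀ x y, π x < π y → blockKey f x ≤ blockKey f y) ∧
      ∀ x y, π x < π y → blockKey f x = blockKey f y → x < y := by
  have h : blockPerm f = π ↔ π.symm = Tuple.sort (blockKey f) := by
    exact ⟨fun h => by rw [← h]; rfl, fun h => by rw [blockPerm, ← h]; rfl⟩
  rw [h, Tuple.eq_sort_iff]
  refine and_congr ⟨fun hm x y hxy => ?_, fun hm i j hij => ?_⟩
    ⟨fun hs x y hxy hk => ?_, fun hs i j hij hk => ?_⟩
  · simpa using hm hxy.le
  · rcases hij.lt_or_eq with hlt | rfl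
    · exact hm _ _ (by simpa using hlt)
    · exact le_rfl
  · simpa using hs (π x) (π y) hxy (by simpa using hk)
  · exact hs _ _ (by simpa using hij) hk

theorem blockPerm_lt_of_blockKey_lt (f : {x // x ∉ A} → {x // x ∈ A}) {x y : Fin n}
    (h : blockKey f x < blockKey f y) : blockPerm f x < blockPerm f y := by
  by_contra! hle
  rcases hle.lt_or_eq with hlt | heq
  · exact absurd (((eq_blockPerm_iff f _).1 rfl).1 y x hlt) h.not_ge
  · rw [(blockPerm f).injective heq] at h
    exact lt_irrefl _ h

theorem isIdemPerm_blockPerm (hn : 1 ≤ n) (f : {x // x ∉ A} → {x // x ∈ A}) :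
    IsIdemPerm n (blockPerm f) A := by
  refine ⟨fun a ha b hb hab => blockPerm_lt_of_blockKey_lt f ?_, ?_, ?_⟩
  · rw [blockKey_of_mem f ha, blockKey_of_mem f hb]
    omega
  · obtain ⟨x, hx⟩ := (blockPerm f).surjective ⟨0, hn⟩
    by_cases hA : x ∈ A
    · exact ⟨x, hA, by rw [hx]⟩
    · have : blockPerm f (f ⟨x, hA⟩) < blockPerm f x := blockPerm_lt_of_blockKey_lt f (by
        rw [blockKey_of_mem f (f ⟨x, hA⟩).2, blockKey_of_notMem f hA]
        omega)
      rw [hx] at this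
      exact absurd this (Nat.not_lt_zero _)
  · intro u v hu hv huv hC
    obtain ⟨x, rfl⟩ := (blockPerm f).surjective u
    obtain ⟨y, rfl⟩ := (blockPerm f).surjective v
    have hx : x ∉ A := fun h => hu (Finset.mem_image_of_mem _ h)
    have hy : y ∉ A := fun h => hv (Finset.mem_image_of_mem _ h)
    simp only [Equiv.symm_apply_apply]
    obtain ⟨h₁, h₂⟩ := (eq_blockPerm_iff f _).1 rfl
    refine h₂ x y huv ((h₁ x y huv).antisymm (not_lt.1 fun hlt => hC ?_))
    have hfy := (f ⟨y, hy⟩).2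
    refine ⟨blockPerm f (f ⟨y, hy⟩), Finset.mem_image_of_mem _ hfy,
      blockPerm_lt_of_blockKey_lt f ?_, (blockPerm_lt_of_blockKey_lt f ?_).le⟩
    · rw [blockKey_of_notMem f hx, blockKey_of_notMem f hy] at hlt
      rw [blockKey_of_notMem f hx, blockKey_of_mem f hfy]
      omega
    · rw [blockKey_of_notMem f hy, blockKey_of_mem f hfy]
      omega

theorem blockPerm_injective :
    Function.Injective (blockPerm : ({x // x ∉ A} → {x // x ∈ A}) → Equiv.Perm (Fin n)) := by
  have key : ∀ f g : {x // x ∉ A} → {x // x ∈ A}, blockPerm f = blockPerm g →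
      ∀ x, (g x : Fin n) ≤ f x := by
    rintro f g h ⟨x, hx⟩
    by_contra! hlt
    have h₁ : blockPerm f x < blockPerm f (g ⟨x, hx⟩) := blockPerm_lt_of_blockKey_lt f (by
      rw [blockKey_of_mem f (g ⟨x, hx⟩).2, blockKey_of_notMem f hx]
      omega)
    have h₂ : blockPerm g (g ⟨x, hx⟩) < blockPerm g x := blockPerm_lt_of_blockKey_lt g (by
      rw [blockKey_of_mem g (g ⟨x, hx⟩).2, blockKey_of_notMem g hx]
      omega)
    rw [h] at h₁
    exact lt_asymm h₁ h₂
  exact fun f g h => funext fun x => Subtype.ext ((key g f h.symm x).antisymm (key f g h x))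

theorem IsIdemPerm.exists_blockPerm_eq {π : Equiv.Perm (Fin n)} (h : IsIdemPerm n π A) :
    ∃ f : {x // x ∉ A} → {x // x ∈ A}, blockPerm f = π := by
  obtain ⟨hmono, ⟨a₀, ha₀, h0⟩, hC⟩ := h
  have hmono' : ∀ a ∈ A, ∀ b ∈ A, π a < π b → a < b := fun a ha b hb hab =>
    not_le.1 fun hba => by
      rcases hba.lt_or_eq with hlt | rfl
      · exact lt_asymm hab (hmono b hb a ha hlt)
      · exact lt_irrefl _ hab
  have hex : ∀ x : {x // x ∉ A}, ∃ a : {x // x ∈ A}, π a < π x ∧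
      ∀ b ∈ A, π b < π x → b ≤ a := by
    rintro ⟨x, hx⟩
    have hne : (A.filter fun a => π a < π x).Nonempty := by
      refine ⟨a₀, Finset.mem_filter.2 ⟨ha₀, ?_⟩⟩
      have : π a₀ ≠ π x := fun e => hx (π.injective e ▸ ha₀)
      omega
    have hm := Finset.mem_filter.1 (Finset.max'_mem _ hne)
    exact ⟨⟨_, hm.1⟩, hm.2, fun b hb hbx => Finset.le_max' _ _ (Finset.mem_filter.2 ⟨hb, hbx⟩)⟩
  choose f hf hmax using hex
  refine ⟨f, (eq_blockPerm_iff f π).2 ⟨fun x y hxy => ?_, fun x y hxy hkey => ?_⟩⟩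
  · by_cases hx : x ∈ A <;> by_cases hy : y ∈ A
    · have := hmono' x hx y hy hxy
      rw [blockKey_of_mem f hx, blockKey_of_mem f hy]
      omega
    · have := hmax ⟨y, hy⟩ x hx hxy
      rw [blockKey_of_mem f hx, blockKey_of_notMem f hy]
      omega
    · have := hmono' _ (f ⟨x, hx⟩).2 y hy ((hf ⟨x, hx⟩).trans hxy)
      rw [blockKey_of_notMem f hx, blockKey_of_mem f hy]
      omega
    · have := hmax ⟨y, hy⟩ _ (f ⟨x, hx⟩).2 ((hf ⟨x, hx⟩).trans hxy)
      rw [blockKey_of_notMem f hx, blockKey_of_notMem f hy]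
      omega
  · by_cases hx : x ∈ A <;> by_cases hy : y ∈ A
    · rw [blockKey_of_mem f hx, blockKey_of_mem f hy] at hkey
      have : x = y := by omega
      exact absurd hxy (this ▸ lt_irrefl _)
    · rw [blockKey_of_mem f hx, blockKey_of_notMem f hy] at hkey
      omega
    · rw [blockKey_of_notMem f hx, blockKey_of_mem f hy] at hkey
      omega
    · rw [blockKey_of_notMem f hx, blockKey_of_notMem f hy] at hkey
      have hfxy : (f ⟨x, hx⟩ : Fin n) = f ⟨y, hy⟩ := by omega
      have hnot : ∀ z, z ∉ A → π z ∉ A.image π := fun z hz hz' => by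
        obtain ⟨a, ha, e⟩ := Finset.mem_image.1 hz'
        exact hz (π.injective e ▸ ha)
      have := hC (π x) (π y) (hnot x hx) (hnot y hy) hxy ?_
      · simpa using this
      rintro ⟨c, hc, hxc, hcy⟩
      obtain ⟨b, hb, rfl⟩ := Finset.mem_image.1 hc
      have hby : π b < π y := lt_of_le_of_ne hcy fun e => hy (π.injective e ▸ hb)
      have hbf := hmax ⟨y, hy⟩ b hb hby
      rw [← hfxy] at hbf
      have := hmono' _ (f ⟨x, hx⟩).2 b hb ((hf ⟨x, hx⟩).trans hxc)
      exact absurd this hbf.not_gt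

theorem card_isIdemPerm (hn : 1 ≤ n) (A : Finset (Fin n)) :
    Nat.card {π : Equiv.Perm (Fin n) // IsIdemPerm n π A} = A.card ^ (n - A.card) := by
  have e : ({x // x ∉ A} → {x // x ∈ A}) ≃ {π : Equiv.Perm (Fin n) // IsIdemPerm n π A} :=
    Equiv.ofBijective (fun f => ⟨blockPerm f, isIdemPerm_blockPerm hn f⟩)
      ⟨fun f g h => blockPerm_injective (Subtype.ext_iff.1 h),
        fun ⟨_, h⟩ => h.exists_blockPerm_eq.imp fun _ hf => Subtype.ext hf⟩
  rw [← Nat.card_congr e, Nat.card_eq_fintype_card]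
  simp [Fintype.card_subtype_compl]

end IdemPerm

/-- The total number of idempotent permutations on `[n]` (over all degrees
`k` from `1` to `n`) equals `∑_{k=1}^{n} C(n,k) · k^(n-k)`. -/
theorem card_idemPerm_total (n : ℕ) (hn : 1 ≤ n) :
    Nat.card {p : Equiv.Perm (Fin n) × Finset (Fin n) //
        ∃ k, 1 ≤ k ∧ k ≤ n ∧ p.2.card = k ∧ IsIdemPerm n p.1 p.2} =
      ∑ k ∈ Finset.Icc 1 n, n.choose k * k ^ (n - k) := by
  have e : {p : Equiv.Perm (Fin n) × Finset (Fin n) //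
      ∃ k, 1 ≤ k ∧ k ≤ n ∧ p.2.card = k ∧ IsIdemPerm n p.1 p.2} ≃
      Σ A : Finset (Fin n), {π : Equiv.Perm (Fin n) // IsIdemPerm n π A} :=
    { toFun := fun p => ⟨p.1.2, p.1.1, by obtain ⟨_, _, _, _, h⟩ := p.2; exact h⟩
      invFun := fun q => ⟨(q.2.1, q.1), q.1.card,
        Finset.card_pos.2 (by obtain ⟨a, ha, _⟩ := q.2.2.2.1; exact ⟨a, ha⟩),
        by simpa using Finset.card_le_univ q.1, rfl, q.2.2⟩
      left_inv := fun _ => rfl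
      right_inv := fun _ => rfl }
  rw [Nat.card_congr e, Nat.card_sigma]
  simp only [card_isIdemPerm hn]
  have h := Finset.sum_powerset_apply_card (fun k => k ^ (n - k)) (x := (Finset.univ : Finset (Fin n)))
  rw [Finset.powerset_univ, Finset.card_univ, Fintype.card_fin] at h
  rw [h, Finset.sum_range_eq_add_Ico _ (Nat.succ_pos n)]
  simp [Nat.pos_iff_ne_zero.1 hn, Finset.Ico_add_one_right_eq_Icc]
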